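/- Let n ≥ 2 be an integer such that either n is prime and n+1 is a power of 2 (n is a Mersenne prime), or n+1 is prime and n is a power of 2 (n+1 is a Fermat prime). Then τ(n) = T_n - 1. -/

import Mathlib

/-- The triangular number `T m = m(m+1)/2`. -/
def T (m : ℕ) : ℕ := m * (m + 1) / 2

theorem two_mul_T (m : ℕ) : 2 * T m = m * (m + 1) :=
  Nat.mul_div_cancel' (Nat.even_mul_succ_self m).two_dvd

/-- The factorizations of `p * 2 ^ j` into two factors of opposite parity. -/
theorem eq_one_or_eq_of_mul_eq_prime_mul_two_pow {p j d e : ℕ} (hp : p.Prime)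
    (hde : d * e = p * 2 ^ j) (hlt : d < e) (hodd : Odd (d + e)) :
    d = 1 ∨ (d = p ∧ e = 2 ^ j) ∨ (d = 2 ^ j ∧ e = p) := by
  have split : ∀ c f : ℕ, c * f = 2 ^ j → Odd (p * c + f) → c = 1 ∨ f = 1 := by
    intro c f hcf ho
    obtain ⟨a, -, rfl⟩ := (Nat.dvd_prime_pow Nat.prime_two).1 (Dvd.intro _ hcf)
    obtain ⟨b, -, rfl⟩ := (Nat.dvd_prime_pow Nat.prime_two).1 (Dvd.intro_left _ hcf)
    rcases a with _ | a
    · simp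
    rcases b with _ | b
    · simp
    · exact absurd ho (by simp [pow_succ, parity_simps])
  rcases hp.dvd_mul.1 (Dvd.intro _ hde.symm) with ⟨c, rfl⟩ | ⟨c, rfl⟩
  · have hc : c * e = 2 ^ j := Nat.eq_of_mul_eq_mul_left hp.pos (by rw [← hde]; ring)
    rcases split c e hc hodd with rfl | rfl
    · simp_all
    · have : 0 < p * 2 ^ j := Nat.mul_pos hp.pos (Nat.two_pow_pos j)
      omega
  · have hc : c * d = 2 ^ j := Nat.eq_of_mul_eq_mul_left hp.pos (by rw [← hde]; ring)
    rcases split c d hc (by rwa [add_comm]) with rfl | rfl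
    · simp_all
    · simp

/-- If `n ≥ 2` and either `n` is a Mersenne prime (`n` prime with `n+1` a
power of 2) or `n+1` is a Fermat prime (`n+1` prime with `n` a power of 2), then
`τ(n) = T n - 1`, i.e. `T n - 1` is the least positive `k` with `T n + T k` triangular. -/
theorem tau_mersenne_fermat (n : ℕ) (hn : 2 ≤ n)
    (h : (Nat.Prime n ∧ ∃ j : ℕ, n + 1 = 2 ^ j) ∨
         (Nat.Prime (n + 1) ∧ ∃ j : ℕ, n = 2 ^ j)) :
    IsLeast {k : ℕ | 0 < k ∧ ∃ m : ℕ, T n + T k = T m} (T n - 1) := by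
  have hTn := two_mul_T n
  have hT : 3 ≤ T n := by nlinarith
  refine ⟨⟨by omega, T n, ?_⟩, ?_⟩
  · obtain ⟨t, ht⟩ : ∃ t, T n = t + 1 := ⟨T n - 1, by omega⟩
    rw [ht, Nat.add_sub_cancel]
    have h₁ := two_mul_T t
    have h₂ := two_mul_T (t + 1)
    linarith
  · rintro k ⟨hk, m, hm⟩
    have hTk := two_mul_T k
    have hTm := two_mul_T m
    have hkm : k < m := by
      by_contra! hle
      nlinarith
    obtain ⟨d, rfl⟩ := Nat.exists_eq_add_of_lt hkm
    have hfac : (d + 1) * (d + 1 + 2 * k + 1) = n * (n + 1) := by linarith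
    have hlt : d + 1 < d + 1 + 2 * k + 1 := by omega
    have hodd : Odd (d + 1 + (d + 1 + 2 * k + 1)) := ⟨d + 1 + k, by ring⟩
    have hd : d = 0 := by
      rcases h with ⟨hp, j, hj⟩ | ⟨hp, j, hj⟩
      · have := eq_one_or_eq_of_mul_eq_prime_mul_two_pow hp (hj ▸ hfac) hlt hodd
        omega
      · have := eq_one_or_eq_of_mul_eq_prime_mul_two_pow (j := j) hp
          (by rw [hfac, ← hj, mul_comm]) hlt hodd
        omega
    subst hd
    omega
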